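/- Consider N ≥ 2 planar double-integrator agents with state in the admissible set C*, a host agent index i, a baseline control u_{0i} ∈ ℝ², and arbitrary disturbance estimates ŵ_j ∈ ℝ² for j ≠ i. Then the PCCA QP — minimize ‖u_{ii} − u_{0i}‖² + Σ_{j ≠ i} ‖u_{ij}‖² over (u_{i1},…,u_{iN}) ∈ (ℝ²)^N subject to a_ij + b_ij(u_{ii} − u_{ij} − ŵ_j) ≥ 0 for all j ≠ i and a_jk + b_jk(u_{ij} + ŵ_j − u_{ik} − ŵ_k) ≥ 0 for all j ≠ k with j, k ≠ i — is feasible and has a unique minimizer. -/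

import Mathlib

open scoped InnerProductSpace

/-- Constraint data `a_ij` for the pairwise barrier between agents `i` and `j`. -/
noncomputable def aConstr {N : ℕ} (r l₀ l₁ : ℝ)
    (ξ v : Fin N → EuclideanSpace ℝ (Fin 2)) (i j : Fin N) : ℝ :=
  2 * ‖v i - v j‖ ^ 2 + 2 * l₁ * ⟪ξ i - ξ j, v i - v j⟫_ℝ
    + l₀ * (‖ξ i - ξ j‖ ^ 2 - r ^ 2)

/-- Constraint row `b_ij u = 2 ξ_ijᵀ u`. -/
noncomputable def bConstr {N : ℕ} (ξ : Fin N → EuclideanSpace ℝ (Fin 2))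
    (i j : Fin N) (u : EuclideanSpace ℝ (Fin 2)) : ℝ :=
  2 * ⟪ξ i - ξ j, u⟫_ℝ

/-- The admissible set `C*`: for all `i ≠ j`, `h_ij ≥ 0` and `ḣ_ij + λ₁ h_ij ≥ 0`. -/
def admissible {N : ℕ} (r lam : ℝ) (ξ v : Fin N → EuclideanSpace ℝ (Fin 2)) : Prop :=
  ∀ i j : Fin N, i ≠ j →
    ‖ξ i - ξ j‖ ^ 2 - r ^ 2 ≥ 0 ∧
    2 * ⟪ξ i - ξ j, v i - v j⟫_ℝ + lam * (‖ξ i - ξ j‖ ^ 2 - r ^ 2) ≥ 0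

/-- Feasible set of the PCCA QP of host `i` with disturbance estimates `ŵ`. -/
def pccaFeasible {N : ℕ} (r l₀ l₁ : ℝ)
    (ξ v : Fin N → EuclideanSpace ℝ (Fin 2)) (i : Fin N)
    (w : Fin N → EuclideanSpace ℝ (Fin 2))
    (u : Fin N → EuclideanSpace ℝ (Fin 2)) : Prop :=
  (∀ j : Fin N, j ≠ i →
    aConstr r l₀ l₁ ξ v i j + bConstr ξ i j (u i - u j - w j) ≥ 0) ∧
  (∀ j k : Fin N, j ≠ k → j ≠ i → k ≠ i →
    aConstr r l₀ l₁ ξ v j k + bConstr ξ j k (u j + w j - u k - w k) ≥ 0)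

/-- Cost of the PCCA QP of host `i`: `‖u_ii − u₀i‖² + Σ_{j ≠ i} ‖u_ij‖²`. -/
noncomputable def pccaCost {N : ℕ} (i : Fin N) (u₀i : EuclideanSpace ℝ (Fin 2))
    (u : Fin N → EuclideanSpace ℝ (Fin 2)) : ℝ :=
  ‖u i - u₀i‖ ^ 2 + ∑ j ∈ Finset.univ.erase i, ‖u j‖ ^ 2

/-- In a real Hilbert space, the projection of `z` onto a nonempty closed convex set exists, and
the distance to `z` exceeds its minimum quantitatively away from the projection. -/
theorem exists_mem_norm_sq_add_norm_sq_le {E : Type*} [NormedAddCommGroup E]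
    [InnerProductSpace ℝ E] [CompleteSpace E] {K : Set E} (hne : K.Nonempty)
    (hclosed : IsClosed K) (hconv : Convex ℝ K) (z : E) :
    ∃ x ∈ K, ∀ y ∈ K, ‖x - z‖ ^ 2 + ‖y - x‖ ^ 2 ≤ ‖y - z‖ ^ 2 := by
  obtain ⟨x, hx, hmin⟩ := exists_norm_eq_iInf_of_complete_convex hne hclosed.isComplete hconv z
  refine ⟨x, hx, fun y hy => ?_⟩
  have hinner := (norm_eq_iInf_iff_real_inner_le_zero hconv hx).1 hmin y hy
  have hexpand := norm_sub_sq_real (y - x) (z - x)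
  rw [sub_sub_sub_cancel_right, real_inner_comm, norm_sub_rev z x] at hexpand
  linarith

theorem isClosed_setOf_pccaFeasible {N : ℕ} (r l₀ l₁ : ℝ)
    (ξ v : Fin N → EuclideanSpace ℝ (Fin 2)) (i : Fin N) (w : Fin N → EuclideanSpace ℝ (Fin 2)) :
    IsClosed {u | pccaFeasible r l₀ l₁ ξ v i w u} := by
  simp only [pccaFeasible, bConstr, ge_iff_le, Set.ofPred_and, Set.ofPred_forall]
  refine IsClosed.inter ?_ ?_
  · refine isClosed_iInter fun j => isClosed_iInter fun _ => ?_
    exact isClosed_le (by fun_prop) (by fun_prop)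
  · refine isClosed_iInter fun j => isClosed_iInter fun k => isClosed_iInter fun _ =>
      isClosed_iInter fun _ => isClosed_iInter fun _ => ?_
    exact isClosed_le (by fun_prop) (by fun_prop)

theorem convex_setOf_pccaFeasible {N : ℕ} (r l₀ l₁ : ℝ)
    (ξ v : Fin N → EuclideanSpace ℝ (Fin 2)) (i : Fin N) (w : Fin N → EuclideanSpace ℝ (Fin 2)) :
    Convex ℝ {u | pccaFeasible r l₀ l₁ ξ v i w u} := by
  intro x hx y hy s t hs ht hst
  obtain rfl : t = 1 - s := by linarith
  refine ⟨fun j hj => ?_, fun j k hjk hj hk => ?_⟩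
  · have hxj := mul_nonneg hs (hx.1 j hj)
    have hyj := mul_nonneg ht (hy.1 j hj)
    simp only [bConstr, Pi.add_apply, Pi.smul_apply, inner_sub_right, inner_add_right,
      inner_smul_right] at hxj hyj ⊢
    linarith
  · have hxj := mul_nonneg hs (hx.2 j k hjk hj hk)
    have hyj := mul_nonneg ht (hy.2 j k hjk hj hk)
    simp only [bConstr, Pi.add_apply, Pi.smul_apply, inner_sub_right, inner_add_right,
      inner_smul_right] at hxj hyj ⊢
    linarith

/-- Damping every relative velocity with gain `l₁` leaves only nonnegative terms in each barrier. -/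
theorem aConstr_add_bConstr_damping_nonneg {N : ℕ} {r l₀ l₁ : ℝ} (hl₀ : 0 ≤ l₀)
    (ξ v : Fin N → EuclideanSpace ℝ (Fin 2)) {j k : Fin N}
    (hjk : 0 ≤ ‖ξ j - ξ k‖ ^ 2 - r ^ 2) :
    0 ≤ aConstr r l₀ l₁ ξ v j k + bConstr ξ j k (-l₁ • (v j - v k)) := by
  have hbarrier := mul_nonneg hl₀ hjk
  simp only [aConstr, bConstr, inner_smul_right]
  linarith [sq_nonneg ‖v j - v k‖]

theorem exists_pccaFeasible {N : ℕ} {r l₀ l₁ lam : ℝ} (hl₀ : 0 ≤ l₀)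
    {ξ v : Fin N → EuclideanSpace ℝ (Fin 2)} (hadm : admissible r lam ξ v)
    (i : Fin N) (w : Fin N → EuclideanSpace ℝ (Fin 2)) :
    ∃ u, pccaFeasible r l₀ l₁ ξ v i w u := by
  refine ⟨fun j => if j = i then -l₁ • v j else -l₁ • v j - w j,
    fun j hj => ?_, fun j k hjk hj hk => ?_⟩
  · convert aConstr_add_bConstr_damping_nonneg hl₀ ξ v (hadm i j hj.symm).1 using 3
    simp only [hj, if_true, if_false]
    module
  · convert aConstr_add_bConstr_damping_nonneg hl₀ ξ v (hadm j k hjk).1 using 3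
    simp only [hj, hk, if_false]
    module

theorem pccaCost_eq_norm_sq {N : ℕ} (i : Fin N) (u₀i : EuclideanSpace ℝ (Fin 2))
    (u : Fin N → EuclideanSpace ℝ (Fin 2)) :
    pccaCost i u₀i u = ‖WithLp.toLp 2 u - WithLp.toLp 2 (Pi.single i u₀i)‖ ^ 2 := by
  rw [PiLp.norm_sq_eq_of_L2, ← Finset.add_sum_erase _ _ (Finset.mem_univ i), pccaCost]
  congr 1
  · simp
  · refine Finset.sum_congr rfl fun j hj => ?_
    simp [Finset.ne_of_mem_erase hj]

/-- On the admissible set `C*`, the PCCA QP is feasible and has a unique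
minimizer, for any baseline control `u₀i` and disturbance estimates `ŵ`. -/
theorem pcca_qp_feasible_unique_minimizer
    (N : ℕ) (hN : 2 ≤ N)
    (r l₀ l₁ lam : ℝ) (hr : 0 < r) (hl₀ : 0 < l₀) (hl₁ : 0 < l₁)
    (hdisc : l₁ ^ 2 ≥ 4 * l₀)
    (hlam : lam = (l₁ + Real.sqrt (l₁ ^ 2 - 4 * l₀)) / 2)
    (ξ v : Fin N → EuclideanSpace ℝ (Fin 2))
    (hadm : admissible r lam ξ v)
    (i : Fin N) (u₀i : EuclideanSpace ℝ (Fin 2))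
    (w : Fin N → EuclideanSpace ℝ (Fin 2)) :
    ∃ ustar : Fin N → EuclideanSpace ℝ (Fin 2),
      pccaFeasible r l₀ l₁ ξ v i w ustar ∧
      (∀ u, pccaFeasible r l₀ l₁ ξ v i w u →
        pccaCost i u₀i ustar ≤ pccaCost i u₀i u) ∧
      (∀ u, pccaFeasible r l₀ l₁ ξ v i w u →
        pccaCost i u₀i u = pccaCost i u₀i ustar → u = ustar) := by
  set K : Set (PiLp 2 fun _ : Fin N => EuclideanSpace ℝ (Fin 2)) :=
    WithLp.ofLp ⁻¹' {u | pccaFeasible r l₀ l₁ ξ v i w u}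
  have hne : K.Nonempty := by
    obtain ⟨u, hu⟩ := exists_pccaFeasible (l₁ := l₁) hl₀.le hadm i w
    exact ⟨WithLp.toLp 2 u, hu⟩
  have hclosed : IsClosed K :=
    (isClosed_setOf_pccaFeasible r l₀ l₁ ξ v i w).preimage (PiLp.continuous_ofLp 2 _)
  have hconv : Convex ℝ K :=
    (convex_setOf_pccaFeasible r l₀ l₁ ξ v i w).linear_preimage
      (WithLp.linearEquiv 2 ℝ (Fin N → EuclideanSpace ℝ (Fin 2))).toLinearMap
  obtain ⟨x, hx, hmin⟩ :=
    exists_mem_norm_sq_add_norm_sq_le hne hclosed hconv (WithLp.toLp 2 (Pi.single i u₀i))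
  have hcost : ∀ u, pccaFeasible r l₀ l₁ ξ v i w u →
      pccaCost i u₀i x.ofLp + ‖WithLp.toLp 2 u - x‖ ^ 2 ≤ pccaCost i u₀i u := by
    intro u hu
    rw [pccaCost_eq_norm_sq, pccaCost_eq_norm_sq]
    exact hmin (WithLp.toLp 2 u) hu
  refine ⟨x.ofLp, hx, fun u hu => ?_, fun u hu heq => ?_⟩
  · linarith [hcost u hu, sq_nonneg ‖WithLp.toLp 2 u - x‖]
  · have hnorm : ‖WithLp.toLp 2 u - x‖ ^ 2 = 0 :=
      le_antisymm (by linarith [hcost u hu]) (sq_nonneg _)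
    exact congrArg WithLp.ofLp
      (sub_eq_zero.1 (norm_eq_zero.1 (pow_eq_zero_iff two_ne_zero |>.1 hnorm)))
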